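/- arXiv:2403.06055 — 10 statements merged into one kernel-verified Lean document; each statement's English description precedes it below -/
import Mathlib

section
/- U and V are fixed by the anti-automorphism: U* = U and V* = V. (Proposition 3.2 of the paper: the infinite-dimensional matrices U and V are symmetric.) -/
theorem IsSelfAdjoint.invOf_sub_mul_mul {R : Type*} [Ring R] [StarRing R] {x a b : R}
    [Invertible a] (hx : star x = -x) (ha : IsSelfAdjoint a) (hb : IsSelfAdjoint b) :
    IsSelfAdjoint (⅟a - x * b * x) :=
  ha.invOf.sub <| by simp [isSelfAdjoint_iff, hx, hb.star_eq, mul_assoc]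

/-- Proposition 3.2: the matrices `U` and `V` are fixed by the involutive
anti-automorphism `star` (i.e. they are symmetric). -/
theorem stmt_0 (R : Type*) [Ring R] [StarRing R]
    (Ω C₁ C₂ : R)
    (hΩ : star Ω = -Ω) (hC₁s : star C₁ = C₁) (hC₂s : star C₂ = C₂)
    [Invertible C₁] [Invertible C₂]
    [Invertible (⅟C₁ - Ω * C₂ * Ω)] [Invertible (⅟C₂ - Ω * C₁ * Ω)]
    (U V : R)
    (hU : U = ⅟(⅟C₁ - Ω * C₂ * Ω))
    (hV : V = ⅟(⅟C₂ - Ω * C₁ * Ω)) :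
    star U = U ∧ star V = V := by
  subst hU hV
  exact ⟨(IsSelfAdjoint.invOf_sub_mul_mul hΩ hC₁s hC₂s).invOf.star_eq,
    (IsSelfAdjoint.invOf_sub_mul_mul hΩ hC₂s hC₁s).invOf.star_eq⟩
end

section
/- The evolution relations hold: D(U) = L·U + U·L* + Ū·O_L·U - U·O_L·V̄ and D(V) = -L·V - V·L* - V̄·O_L·V + V·O_L·Ū. (Proposition 3.3 of the paper, with L playing the role of Λⁿ and D of ∂/∂xₙ.) -/
/-- A derivation `D` of a ring sends the inverse `y` of `x` to `-(y * D x * y)`. -/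
theorem leibniz_map_inverse {R : Type*} [Ring R] {D : R → R}
    (hmul : ∀ x y, D (x * y) = D x * y + x * D y)
    {x y : R} (hxy : x * y = 1) (hyx : y * x = 1) : D y = -(y * D x * y) := by
  have h0 : D 1 = 0 := by simpa using hmul 1 1
  have h : D x * y + x * D y = 0 := by rw [← hmul, hxy, h0]
  calc D y = y * x * D y := by rw [hyx, one_mul]
    _ = y * (D x * y + x * D y) - y * D x * y := by noncomm_ring
    _ = -(y * D x * y) := by rw [h, mul_zero, zero_sub]

/-- Evolution of `U = (A⁻¹ - Ω * B * Ω)⁻¹` under a derivation with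
`D A = L * A + A * S` and `D B = -(L * B + B * S)`. -/
theorem leibniz_map_inverse_sub_conj {R : Type*} [Ring R] {D : R → R}
    (hadd : ∀ x y, D (x + y) = D x + D y) (hmul : ∀ x y, D (x * y) = D x * y + x * D y)
    {Ω A B A' B' U V L S : R} (hΩ : D Ω = 0)
    (hA : D A = L * A + A * S) (hB : D B = -(L * B + B * S))
    (hAA' : A * A' = 1) (hA'A : A' * A = 1) (hB'B : B' * B = 1)
    (hMU : (A' - Ω * B * Ω) * U = 1) (hUM : U * (A' - Ω * B * Ω) = 1)
    (hVN : V * (B' - Ω * A * Ω) = 1) :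
    D U = L * U + U * S + -(U * Ω * B) * (S * Ω - Ω * L) * U
      - U * (S * Ω - Ω * L) * -(V * Ω * A) := by
  have hA'D : D A' = -(A' * L) - S * A' := by
    rw [leibniz_map_inverse hmul hAA' hA'A, hA]
    calc -(A' * (L * A + A * S) * A') = -(A' * L * (A * A')) - (A' * A) * S * A' := by
          noncomm_ring
      _ = -(A' * L) - S * A' := by rw [hAA', hA'A, mul_one, one_mul]
  have hMD : D (A' - Ω * B * Ω) = -(A' * L) - S * A' + Ω * (L * B + B * S) * Ω := by
    have h := hadd (A' - Ω * B * Ω) (Ω * B * Ω)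
    rw [sub_add_cancel, hA'D, hmul, hmul, hΩ, hB] at h
    rw [← sub_eq_iff_eq_add] at h
    rw [← h]
    noncomm_ring
  have hVM : V * Ω * A * (A' - Ω * B * Ω) = B * Ω := by
    calc V * Ω * A * (A' - Ω * B * Ω)
        = V * Ω * (A * A') - V * Ω * A * Ω * B * Ω := by noncomm_ring
      _ = V * (B' * B) * Ω - V * Ω * A * Ω * B * Ω := by rw [hAA', hB'B]; noncomm_ring
      _ = V * (B' - Ω * A * Ω) * (B * Ω) := by noncomm_ring
      _ = B * Ω := by rw [hVN, one_mul]
  have hV : V * Ω * A = B * Ω * U := by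
    rw [← hVM, mul_assoc _ _ U, hMU, mul_one]
  rw [leibniz_map_inverse hmul hMU hUM, hMD, hV]
  have h₁ : U * A' = 1 + U * Ω * B * Ω := by
    rw [← hUM]; noncomm_ring
  have h₂ : A' * U = 1 + Ω * B * Ω * U := by
    rw [← hMU]; noncomm_ring
  calc -(U * (-(A' * L) - S * A' + Ω * (L * B + B * S) * Ω) * U)
      = (U * A') * L * U + U * S * (A' * U) - U * Ω * (L * B + B * S) * Ω * U := by
        noncomm_ring
    _ = _ := by rw [h₁, h₂]; noncomm_ring

/-- Proposition 3.3: the evolution relations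
`D(U) = L·U + U·L* + Ū·O_L·U - U·O_L·V̄` and
`D(V) = -L·V - V·L* - V̄·O_L·V + V·O_L·Ū`. -/
theorem stmt_2 (R : Type*) [Ring R] [StarRing R]
    (Ω C₁ C₂ : R)
    (hΩ : star Ω = -Ω) (hC₁s : star C₁ = C₁) (hC₂s : star C₂ = C₂)
    [Invertible C₁] [Invertible C₂]
    [Invertible (⅟C₁ - Ω * C₂ * Ω)] [Invertible (⅟C₂ - Ω * C₁ * Ω)]
    (U V Ub Vb : R)
    (hU : U = ⅟(⅟C₁ - Ω * C₂ * Ω))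
    (hV : V = ⅟(⅟C₂ - Ω * C₁ * Ω))
    (hUb : Ub = -(U * Ω * C₂))
    (hVb : Vb = -(V * Ω * C₁))
    (L OL : R)
    (hL1 : L * C₁ = C₁ * star L) (hL2 : L * C₂ = C₂ * star L)
    (hOL : OL = star L * Ω - Ω * L)
    (D : R → R)
    (hDadd : ∀ x y, D (x + y) = D x + D y)
    (hDmul : ∀ x y, D (x * y) = D x * y + x * D y)
    (hDΩ : D Ω = 0) (hDL : D L = 0) (hDLs : D (star L) = 0)
    (hDC₁ : D C₁ = L * C₁ + C₁ * star L)
    (hDC₂ : D C₂ = -(L * C₂ + C₂ * star L)) :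
    D U = L * U + U * star L + Ub * OL * U - U * OL * Vb ∧
    D V = -(L * V) - V * star L - Vb * OL * V + V * OL * Ub := by
  subst hU hV hUb hVb hOL
  refine ⟨leibniz_map_inverse_sub_conj hDadd hDmul hDΩ hDC₁ hDC₂ (mul_invOf_self C₁)
    (invOf_mul_self C₁) (invOf_mul_self C₂) (mul_invOf_self _) (invOf_mul_self _)
    (invOf_mul_self _), ?_⟩
  have h := leibniz_map_inverse_sub_conj (D := fun x => -D x) (A := C₂) (B := C₁) (Ω := Ω)
    (L := L) (S := star L)
    (fun x y => by simp only [hDadd]; abel) (fun x y => by simp only [hDmul]; noncomm_ring)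
    (by simp only [hDΩ, neg_zero]) (by simp only [hDC₂, neg_neg]) (by simp only [hDC₁])
    (mul_invOf_self C₂)
    (invOf_mul_self C₂) (invOf_mul_self C₁) (mul_invOf_self (⅟C₂ - Ω * C₁ * Ω))
    (invOf_mul_self _) (invOf_mul_self (⅟C₁ - Ω * C₂ * Ω))
  rw [← neg_neg (D _), h]
  noncomm_ring
end

section
/- The purely algebraic 'difference' relations hold: U·L* - L·U = Ū·O_L·U + U·O_L·V̄ and V·L* - L·V = V̄·O_L·V + V·O_L·Ū. (Proposition 3.5 of the paper, with L playing the role of Λⁿ.) -/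
/-- The push-through identity `(b - Ω a Ω)⁻¹ Ω a = c Ω (d - Ω c Ω)⁻¹`, where `b = c⁻¹`, `d = a⁻¹`. -/
theorem invOf_mul_mul_eq_mul_mul_invOf {R : Type*} [Ring R] (Ω a c : R)
    [Invertible a] [Invertible c]
    [Invertible (⅟a - Ω * c * Ω)] [Invertible (⅟c - Ω * a * Ω)] :
    ⅟(⅟c - Ω * a * Ω) * Ω * a = c * Ω * ⅟(⅟a - Ω * c * Ω) := by
  have key : Ω * a * (⅟a - Ω * c * Ω) = (⅟c - Ω * a * Ω) * (c * Ω) := by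
    simp only [mul_sub, sub_mul, mul_assoc, mul_invOf_self, mul_one, invOf_mul_cancel_left]
  calc ⅟(⅟c - Ω * a * Ω) * Ω * a
      = ⅟(⅟c - Ω * a * Ω) * (Ω * a * (⅟a - Ω * c * Ω)) * ⅟(⅟a - Ω * c * Ω) := by
        rw [mul_assoc _ _ (⅟(⅟a - Ω * c * Ω)), mul_invOf_cancel_right, mul_assoc]
    _ = c * Ω * ⅟(⅟a - Ω * c * Ω) := by
        rw [key, invOf_mul_cancel_left]

/-- If `L` and `M` are intertwined by `a` and by `c`, then the failure of `(a⁻¹ - Ω c Ω)⁻¹` to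
intertwine them is governed by `M Ω - Ω L`. -/
theorem invOf_mul_sub_mul_invOf {R : Type*} [Ring R] (Ω a c L M : R)
    [Invertible a] [Invertible c]
    [Invertible (⅟a - Ω * c * Ω)] [Invertible (⅟c - Ω * a * Ω)]
    (ha : L * a = a * M) (hc : L * c = c * M) :
    ⅟(⅟a - Ω * c * Ω) * M - L * ⅟(⅟a - Ω * c * Ω) =
      -(⅟(⅟a - Ω * c * Ω) * Ω * c) * (M * Ω - Ω * L) * ⅟(⅟a - Ω * c * Ω) +
        ⅟(⅟a - Ω * c * Ω) * (M * Ω - Ω * L) * -(⅟(⅟c - Ω * a * Ω) * Ω * a) := by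
  have hinv : M * ⅟a = ⅟a * L := by
    rw [mul_invOf_eq_iff_eq_mul_right, mul_assoc, ha, invOf_mul_cancel_left]
  have hcomm : M * (⅟a - Ω * c * Ω) - (⅟a - Ω * c * Ω) * L =
      -((M * Ω - Ω * L) * (c * Ω)) - Ω * c * (M * Ω - Ω * L) := by
    have h : Ω * L * c * Ω = Ω * c * M * Ω := by
      rw [mul_assoc Ω L, hc, ← mul_assoc Ω c]
    calc M * (⅟a - Ω * c * Ω) - (⅟a - Ω * c * Ω) * L
        = (M * ⅟a - ⅟a * L) - (M * Ω * c * Ω - Ω * c * Ω * L) := by noncomm_ring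
      _ = -(M * Ω * c * Ω) + Ω * L * c * Ω - Ω * c * M * Ω + Ω * c * Ω * L := by
        rw [hinv, h]; noncomm_ring
      _ = _ := by noncomm_ring
  rw [invOf_mul_mul_eq_mul_mul_invOf Ω a c]
  calc ⅟(⅟a - Ω * c * Ω) * M - L * ⅟(⅟a - Ω * c * Ω)
      = ⅟(⅟a - Ω * c * Ω) * (M * (⅟a - Ω * c * Ω) - (⅟a - Ω * c * Ω) * L) *
          ⅟(⅟a - Ω * c * Ω) := by
        rw [mul_sub, sub_mul, ← mul_assoc, mul_invOf_cancel_right, invOf_mul_cancel_left]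
    _ = _ := by
        rw [hcomm]
        generalize ⅟(⅟a - Ω * c * Ω) = U
        noncomm_ring


/-- Proposition 3.5: the algebraic 'difference' relations
`U·L* - L·U = Ū·O_L·U + U·O_L·V̄` and
`V·L* - L·V = V̄·O_L·V + V·O_L·Ū`. -/
theorem stmt_4 (R : Type*) [Ring R] [StarRing R]
    (Ω C₁ C₂ : R)
    (hΩ : star Ω = -Ω) (hC₁s : star C₁ = C₁) (hC₂s : star C₂ = C₂)
    [Invertible C₁] [Invertible C₂]
    [Invertible (⅟C₁ - Ω * C₂ * Ω)] [Invertible (⅟C₂ - Ω * C₁ * Ω)]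
    (U V Ub Vb : R)
    (hU : U = ⅟(⅟C₁ - Ω * C₂ * Ω))
    (hV : V = ⅟(⅟C₂ - Ω * C₁ * Ω))
    (hUb : Ub = -(U * Ω * C₂))
    (hVb : Vb = -(V * Ω * C₁))
    (L OL : R)
    (hL1 : L * C₁ = C₁ * star L) (hL2 : L * C₂ = C₂ * star L)
    (hOL : OL = star L * Ω - Ω * L) :
    U * star L - L * U = Ub * OL * U + U * OL * Vb ∧
    V * star L - L * V = Vb * OL * V + V * OL * Ub := by
  subst hUb hVb hU hV hOL
  exact ⟨invOf_mul_sub_mul_invOf Ω C₁ C₂ L (star L) hL1 hL2,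
    invOf_mul_sub_mul_invOf Ω C₂ C₁ L (star L) hL2 hL1⟩
end

section
/- The dual 'difference' relations hold: Ū·L* - L·Ū = Ū·O_L·Ū + U·O_L·V and V̄·L* - L·V̄ = V̄·O_L·V̄ + V·O_L·U. (Proposition 3.6 of the paper, with L playing the role of Λⁿ.) -/
/-- If `U` and `V` are the inverses of the Schur complements `C₁⁻¹ - Ω * C₂ * Ω` and
`C₂⁻¹ - Ω * C₁ * Ω`, then `U * Ω * C₂ = C₁ * Ω * V`. -/
theorem schur_inverse_mul_comm {R : Type*} [Ring R] {Ω C D C' D' U V : R}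
    (hC : C' * C = 1) (hD : D * D' = 1)
    (hU : U * (C' - Ω * D * Ω) = 1) (hV : (D' - Ω * C * Ω) * V = 1) :
    U * Ω * D = C * Ω * V := by
  have h : Ω * D * (D' - Ω * C * Ω) = (C' - Ω * D * Ω) * (C * Ω) := by
    calc Ω * D * (D' - Ω * C * Ω) = Ω * (D * D') - Ω * D * Ω * C * Ω := by noncomm_ring
      _ = C' * C * Ω - Ω * D * Ω * C * Ω := by rw [hC, hD, mul_one, one_mul]
      _ = (C' - Ω * D * Ω) * (C * Ω) := by noncomm_ring
  calc U * Ω * D = U * (Ω * D * ((D' - Ω * C * Ω) * V)) := by rw [hV, mul_one, mul_assoc]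
    _ = U * (Ω * D * (D' - Ω * C * Ω)) * V := by simp only [mul_assoc]
    _ = U * (C' - Ω * D * Ω) * (C * Ω * V) := by rw [h]; simp only [mul_assoc]
    _ = C * Ω * V := by rw [hU, one_mul]

/-- The off-diagonal entry of the identity `X M - L X = X (M N - N L) X` for the block matrix
`N` with rows `(C', Ω)` and `(Ω, D')` and its inverse `X`. -/
theorem schur_difference_relation {R : Type*} [Ring R] {Ω C D C' D' U V L M : R}
    (hC : C' * C = 1) (hC' : C * C' = 1) (hD : D * D' = 1) (hD' : D' * D = 1)
    (hU : U * (C' - Ω * D * Ω) = 1) (hV : (D' - Ω * C * Ω) * V = 1)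
    (hLC : L * C = C * M) (hLD : L * D = D * M) :
    -(U * Ω * D) * M - L * -(U * Ω * D) =
      -(U * Ω * D) * (M * Ω - Ω * L) * -(U * Ω * D) + U * (M * Ω - Ω * L) * V := by
  have hUV := schur_inverse_mul_comm hC hD hU hV
  have conj_inv {E E' : R} (h : E' * E = 1) (h' : E * E' = 1) (hE : L * E = E * M) :
      E' * L = M * E' := by
    calc E' * L = E' * (L * E) * E' := by rw [mul_assoc, mul_assoc, h', mul_one]
      _ = E' * E * M * E' := by rw [hE]; simp only [mul_assoc]
      _ = M * E' := by rw [h, one_mul]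
  have hC'L := conj_inv hC hC' hLC
  have hD'L := conj_inv hD' hD hLD
  generalize hW : -(U * Ω * D) = W
  have hleft : W * Ω = 1 - U * C' := by rw [← hU, ← hW]; noncomm_ring
  have hWD' : W * D' = -(U * Ω) := by rw [← hW, neg_mul, mul_assoc, hD, mul_one]
  have hC'W : C' * W = -(Ω * V) := by
    rw [← hW, hUV, mul_neg, ← mul_assoc, ← mul_assoc, hC, one_mul]
  have hright : Ω * W = 1 - D' * V := by rw [← hV, ← hW, hUV]; noncomm_ring
  have h₁ : W * M * (Ω * W) = W * M + U * Ω * L * V := by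
    calc W * M * (Ω * W) = W * M - W * (M * D') * V := by rw [hright]; noncomm_ring
      _ = W * M - W * D' * L * V := by rw [← hD'L]; simp only [mul_assoc]
      _ = W * M + U * Ω * L * V := by rw [hWD']; noncomm_ring
  have h₂ : W * Ω * (L * W) = L * W + U * M * Ω * V := by
    calc W * Ω * (L * W) = L * W - U * (C' * L) * W := by rw [hleft]; noncomm_ring
      _ = L * W - U * M * (C' * W) := by rw [hC'L]; simp only [mul_assoc]
      _ = L * W + U * M * Ω * V := by rw [hC'W]; noncomm_ring
  calc W * M - L * W
      = (W * M + U * Ω * L * V) - (L * W + U * M * Ω * V) + U * (M * Ω - Ω * L) * V := by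
        noncomm_ring
    _ = W * (M * Ω - Ω * L) * W + U * (M * Ω - Ω * L) * V := by
        rw [← h₁, ← h₂]; noncomm_ring

/-- Proposition 3.6: the dual 'difference' relations
`Ū·L* - L·Ū = Ū·O_L·Ū + U·O_L·V` and
`V̄·L* - L·V̄ = V̄·O_L·V̄ + V·O_L·U`. -/
theorem stmt_5 (R : Type*) [Ring R] [StarRing R]
    (Ω C₁ C₂ : R)
    (hΩ : star Ω = -Ω) (hC₁s : star C₁ = C₁) (hC₂s : star C₂ = C₂)
    [Invertible C₁] [Invertible C₂]
    [Invertible (⅟C₁ - Ω * C₂ * Ω)] [Invertible (⅟C₂ - Ω * C₁ * Ω)]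
    (U V Ub Vb : R)
    (hU : U = ⅟(⅟C₁ - Ω * C₂ * Ω))
    (hV : V = ⅟(⅟C₂ - Ω * C₁ * Ω))
    (hUb : Ub = -(U * Ω * C₂))
    (hVb : Vb = -(V * Ω * C₁))
    (L OL : R)
    (hL1 : L * C₁ = C₁ * star L) (hL2 : L * C₂ = C₂ * star L)
    (hOL : OL = star L * Ω - Ω * L) :
    Ub * star L - L * Ub = Ub * OL * Ub + U * OL * V ∧
    Vb * star L - L * Vb = Vb * OL * Vb + V * OL * U := by
  subst hU hV hUb hVb hOL
  exact ⟨schur_difference_relation (invOf_mul_self _) (mul_invOf_self _) (mul_invOf_self _)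
      (invOf_mul_self _) (invOf_mul_self _) (mul_invOf_self _) hL1 hL2,
    schur_difference_relation (invOf_mul_self _) (mul_invOf_self _) (mul_invOf_self _)
      (invOf_mul_self _) (invOf_mul_self _) (mul_invOf_self _) hL2 hL1⟩
end

section
/- The block matrix 𝕋 satisfies the evolution relation D(𝕋) = 𝕋·(L*·I)·ℭ - ℭ·(L·I)·𝕋 - 𝕋·ℭ·(O_L·I)·𝕋 (where D acts entrywise on 2×2 matrices over R) and the 'difference' relation 𝕋·(L*·I) - (L·I)·𝕋 = 𝕋·(O_L·I)·𝕋. (Proposition 3.7 of the paper, relations (3.34) and (3.35).) -/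
/-- An additive map satisfying the Leibniz rule satisfies it entrywise on matrix products. -/
theorem Matrix.map_mul_of_leibniz {R n : Type*} [Ring R] [Fintype n] (D : R → R)
    (hDadd : ∀ x y, D (x + y) = D x + D y)
    (hDmul : ∀ x y, D (x * y) = D x * y + x * D y) (A B : Matrix n n R) :
    (A * B).map D = A.map D * B + A * B.map D := by
  ext i j
  have hsum := map_sum (AddMonoidHom.mk' D hDadd) (fun k => A i k * B k j) Finset.univ
  simp only [AddMonoidHom.mk'_apply] at hsum
  simp only [Matrix.map_apply, Matrix.mul_apply, Matrix.add_apply, hsum, hDmul,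
    Finset.sum_add_distrib]

/-- The derivative of an inverse: `D(y) = -y * D(x) * y` when `y` is inverse to `x`. -/
theorem eq_neg_mul_mul_of_leibniz_inverse {S : Type*} [Ring S] {x y x' y' : S}
    (hyx : y * x = 1) (h : x' * y + x * y' = 0) : y' = -(y * x' * y) := by
  have h' : y * (x' * y + x * y') = 0 := by rw [h, mul_zero]
  rw [mul_add, ← mul_assoc y x, hyx, one_mul] at h'
  rw [mul_assoc]
  exact eq_neg_of_add_eq_zero_right h'

/-- The push-through identity relating the inverses of `a - ω * c₂ * ω` and `b - ω * c₁ * ω`,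
where `a`, `b` are inverse to `c₁`, `c₂`. -/
theorem mul_mul_eq_of_inverses {R : Type*} [Ring R] {ω c₁ c₂ a b u v : R}
    (hca : c₁ * a = 1) (hbc : b * c₂ = 1)
    (hu : (a - ω * c₂ * ω) * u = 1) (hv : v * (b - ω * c₁ * ω) = 1) :
    c₂ * ω * u = v * ω * c₁ := by
  have h : (b - ω * c₁ * ω) * (c₂ * ω * u) = ω * c₁ := by
    calc (b - ω * c₁ * ω) * (c₂ * ω * u)
        = (b * c₂) * ω * u - ω * c₁ * (ω * c₂ * ω) * u := by noncomm_ring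
      _ = ω * (c₁ * a) * u - ω * c₁ * (ω * c₂ * ω) * u := by rw [hbc, hca]; simp
      _ = ω * c₁ * ((a - ω * c₂ * ω) * u) := by noncomm_ring
      _ = ω * c₁ := by rw [hu, mul_one]
  calc c₂ * ω * u = v * (b - ω * c₁ * ω) * (c₂ * ω * u) := by rw [hv, one_mul]
    _ = v * ω * c₁ := by rw [mul_assoc, h, mul_assoc]

/-- Conjugating `l * c = c * m` by the inverse of `c`. -/
theorem mul_eq_mul_of_inverse {R : Type*} [Ring R] {a c l m : R}
    (hac : a * c = 1) (hca : c * a = 1) (h : l * c = c * m) : m * a = a * l := by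
  calc m * a = a * (c * m) * a := by rw [← mul_assoc, hac, one_mul]
    _ = a * l * (c * a) := by rw [← h]; simp only [mul_assoc]
    _ = a * l := by rw [hca, mul_one]


/-- Proposition 3.7: the block matrix `𝕋 = [[V̄, V], [U, Ū]]` satisfies the
evolution relation `D(𝕋) = 𝕋·(L*·I)·ℭ - ℭ·(L·I)·𝕋 - 𝕋·ℭ·(O_L·I)·𝕋` (with `D`
acting entrywise) and the 'difference' relation
`𝕋·(L*·I) - (L·I)·𝕋 = 𝕋·(O_L·I)·𝕋`. -/
theorem stmt_6 (R : Type*) [Ring R] [StarRing R]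
    (Ω C₁ C₂ : R)
    (hΩ : star Ω = -Ω) (hC₁s : star C₁ = C₁) (hC₂s : star C₂ = C₂)
    [Invertible C₁] [Invertible C₂]
    [Invertible (⅟C₁ - Ω * C₂ * Ω)] [Invertible (⅟C₂ - Ω * C₁ * Ω)]
    (U V Ub Vb : R)
    (hU : U = ⅟(⅟C₁ - Ω * C₂ * Ω))
    (hV : V = ⅟(⅟C₂ - Ω * C₁ * Ω))
    (hUb : Ub = -(U * Ω * C₂))
    (hVb : Vb = -(V * Ω * C₁))
    (L OL : R)
    (hL1 : L * C₁ = C₁ * star L) (hL2 : L * C₂ = C₂ * star L)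
    (hOL : OL = star L * Ω - Ω * L)
    (D : R → R)
    (hDadd : ∀ x y, D (x + y) = D x + D y)
    (hDmul : ∀ x y, D (x * y) = D x * y + x * D y)
    (hDΩ : D Ω = 0) (hDL : D L = 0) (hDLs : D (star L) = 0)
    (hDC₁ : D C₁ = L * C₁ + C₁ * star L)
    (hDC₂ : D C₂ = -(L * C₂ + C₂ * star L))
    (T Cm : Matrix (Fin 2) (Fin 2) R)
    (hT : T = !![Vb, V; U, Ub])
    (hCm : Cm = !![(1 : R), 0; 0, -1]) :
    T.map D = T * !![star L, 0; 0, star L] * Cm - Cm * !![L, 0; 0, L] * T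
      - T * Cm * !![OL, 0; 0, OL] * T ∧
    T * !![star L, 0; 0, star L] - !![L, 0; 0, L] * T = T * !![OL, 0; 0, OL] * T := by
  have hac := invOf_mul_self C₁
  have hca := mul_invOf_self C₁
  have hbc := invOf_mul_self C₂
  have hcb := mul_invOf_self C₂
  have hUl : U * (⅟C₁ - Ω * C₂ * Ω) = 1 := by rw [hU, invOf_mul_self]
  have hUr : (⅟C₁ - Ω * C₂ * Ω) * U = 1 := by rw [hU, mul_invOf_self]
  have hVl : V * (⅟C₂ - Ω * C₁ * Ω) = 1 := by rw [hV, invOf_mul_self]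
  have hVr : (⅟C₂ - Ω * C₁ * Ω) * V = 1 := by rw [hV, mul_invOf_self]
  clear hU hV
  generalize ⅟C₁ = a at *
  generalize ⅟C₂ = b at *
  have hD0 : D 0 = 0 := by simpa using hDadd 0 0
  have hD1 : D 1 = 0 := by simpa using hDmul 1 1
  have hpU := mul_mul_eq_of_inverses hca hbc hUr hVl
  have hpV := mul_mul_eq_of_inverses hcb hac hVr hUl
  have hMa := mul_eq_mul_of_inverse hac hca hL1
  have hMb := mul_eq_mul_of_inverse hbc hcb hL2
  have hDa : D a = -(a * L + star L * a) := by
    have h : D C₁ * a + C₁ * D a = 0 := by rw [← hDmul, hca, hD1]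
    rw [eq_neg_mul_mul_of_leibniz_inverse hac h, hDC₁, mul_add, add_mul,
      mul_assoc a (L * C₁), mul_assoc L, hca, ← mul_assoc a C₁, hac, mul_one, one_mul]
  have hDb : D b = b * L + star L * b := by
    have h : D C₂ * b + C₂ * D b = 0 := by rw [← hDmul, hcb, hD1]
    rw [eq_neg_mul_mul_of_leibniz_inverse hbc h, hDC₂, mul_neg, neg_mul, neg_neg, mul_add,
      add_mul, mul_assoc b (L * C₂), mul_assoc L, hcb, ← mul_assoc b C₂, hbc, mul_one, one_mul]
  obtain ⟨N, hN⟩ : ∃ N : Matrix (Fin 2) (Fin 2) R, N = !![Ω, a; b, Ω] := ⟨_, rfl⟩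
  have hTN : T * N = 1 := by
    rw [hT, hN, Matrix.mul_fin_two, Matrix.one_fin_two, hUb, hVb]
    congr! 4
    · rw [← hVl]; noncomm_ring
    · rw [neg_mul, mul_assoc _ C₁, hca]; simp
    · rw [neg_mul, mul_assoc _ C₂, hcb]; simp
    · rw [← hUl]; noncomm_ring
  have hNT : N * T = 1 := by
    rw [hT, hN, Matrix.mul_fin_two, Matrix.one_fin_two, hUb, hVb, ← hpU, ← hpV]
    congr! 4
    · rw [← hUr]; noncomm_ring
    · rw [mul_neg, mul_assoc C₁, ← mul_assoc a C₁, hac]; simp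
    · rw [mul_neg, mul_assoc C₂, ← mul_assoc b C₂, hbc]; simp
    · rw [← hVr]; noncomm_ring
  have hDN : N.map D = !![0, -(a * L + star L * a); b * L + star L * b, 0] := by
    rw [hN]
    ext i j
    fin_cases i <;> fin_cases j <;> simp [hDΩ, hDa, hDb]
  have hDT : T.map D = -(T * N.map D * T) := by
    refine eq_neg_mul_mul_of_leibniz_inverse hTN ?_
    rw [← Matrix.map_mul_of_leibniz D hDadd hDmul, hNT]
    ext i j
    fin_cases i <;> fin_cases j <;> simp [hD0, hD1]
  generalize hM : !![star L, 0; 0, star L] = M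
  generalize hΛ : !![L, 0; 0, L] = Λ
  generalize hO : !![OL, 0; 0, OL] = O
  have hdiff : M * N - N * Λ = O := by
    rw [← hM, ← hΛ, ← hO, hN, hOL]
    ext i j
    fin_cases i <;> fin_cases j <;> simp [hMa, hMb]
  have hevol : -N.map D = M * Cm * N - N * Cm * Λ - Cm * O := by
    rw [hDN, ← hM, ← hΛ, ← hO, hCm, hN, hOL]
    ext i j
    fin_cases i <;> fin_cases j <;> simp <;> abel
  constructor
  · calc T.map D = T * (-N.map D) * T := by rw [hDT]; noncomm_ring
      _ = T * M * Cm * (N * T) - (T * N) * Cm * Λ * T - T * Cm * O * T := by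
        rw [hevol]; noncomm_ring
      _ = T * M * Cm - Cm * Λ * T - T * Cm * O * T := by rw [hNT, hTN, mul_one, one_mul]
  · calc T * M - Λ * T = T * M * (N * T) - (T * N) * Λ * T := by
          rw [hNT, hTN, mul_one, one_mul]
      _ = T * O * T := by rw [← hdiff]; noncomm_ring
end

section
/- For every ring S, all infinite matrices A, B : ℤ × ℤ → S, every n ∈ ℤ and all i, j ∈ ℤ, the entry (A·O_n·B)_{i,j} := Σ_{(a,b) ∈ ℤ×ℤ} (O_n)_{a,b} • (A_{i,a}·B_{b,j}) (a finitely supported sum, since O_n has only finitely many nonzero entries) is given by: Σ_{l=0}^{n-1} A_{i,n-1-l}·B_{l,j} if n ≥ 1; 0 if n = 0; and -Σ_{l=n}^{-1} A_{i,n-1-l}·B_{l,j} if n ≤ -1. (Formula (3.41) of the paper, the key step in the proof of Theorem 3.2; taking S to be the ring of 2×2 complex matrices gives the block version used there.) -/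
/-- A finitely supported sum over `ℤ × ℤ` with constant integer weight `e` on the part of the
antidiagonal `a = m - b` lying over `T`. -/
theorem finsum_antidiagonal_smul {M : Type*} [AddCommGroup M] (m e : ℤ) (T : Finset ℤ)
    (c : ℤ → ℤ → ℤ) (hc : ∀ a b, c a b = if a = m - b ∧ b ∈ T then e else 0)
    (f : ℤ → ℤ → M) :
    (∑ᶠ p : ℤ × ℤ, c p.1 p.2 • f p.1 p.2) = e • ∑ l ∈ T, f (m - l) l := by
  classical
  have hsupp : (Function.support fun p : ℤ × ℤ => c p.1 p.2 • f p.1 p.2) ⊆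
      ↑(T.image fun l => (m - l, l)) := by
    rintro ⟨a, b⟩ hp
    by_cases h : a = m - b ∧ b ∈ T
    · simp [h.1, h.2]
    · simp [hc, h] at hp
  rw [finsum_eq_sum_of_support_subset _ hsupp,
    Finset.sum_image fun x _ y _ h => (Prod.mk.inj h).2, Finset.smul_sum]
  exact Finset.sum_congr rfl fun l hl => by simp [hc, hl]

/-- Formula (3.41): for infinite matrices `A`, `B` with entries in a ring `S`,
the entries of `A·O_n·B` are given by the finite sums
`Σ_{l=0}^{n-1} A_{i,n-1-l}·B_{l,j}` for `n ≥ 1`, `0` for `n = 0`, and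
`-Σ_{l=n}^{-1} A_{i,n-1-l}·B_{l,j}` for `n ≤ -1`. -/
theorem stmt_10 (S : Type*) [Ring S]
    (Ωm : ℤ → ℤ → ℤ)
    (hΩ : ∀ i j : ℤ, Ωm i j = if i + j + 1 = 0 ∧ 0 ≤ j then 1 else 0)
    (O : ℤ → ℤ → ℤ → ℤ)
    (hO : ∀ n i j : ℤ, O n i j = Ωm (i - n) j - Ωm i (j - n))
    (A B : ℤ → ℤ → S) (n i j : ℤ) :
    (∑ᶠ p : ℤ × ℤ, O n p.1 p.2 • (A i p.1 * B p.2 j)) =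
      if 1 ≤ n then ∑ l ∈ Finset.Icc (0 : ℤ) (n - 1), A i (n - 1 - l) * B l j
      else if n = 0 then 0
      else -∑ l ∈ Finset.Icc n (-1 : ℤ), A i (n - 1 - l) * B l j := by
  split_ifs with hpos hzero
  · rw [finsum_antidiagonal_smul (n - 1) 1 (Finset.Icc 0 (n - 1)) (O n)
      (fun a b => by rw [hO, hΩ, hΩ]; grind) fun a b => A i a * B b j, one_smul]
  · rw [finsum_antidiagonal_smul (n - 1) 0 ∅ (O n)
      (fun a b => by rw [hO, hΩ, hΩ]; grind) fun a b => A i a * B b j, zero_smul]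
  · rw [finsum_antidiagonal_smul (n - 1) (-1) (Finset.Icc n (-1)) (O n)
      (fun a b => by rw [hO, hΩ, hΩ]; grind) fun a b => A i a * B b j,
      neg_one_smul]
end

section
/- Let M be a positive integer, k₁, …, k_M nonzero complex numbers, and r₁, …, r_M, s₁, …, s_M complex numbers. Set l_j := -1/conj(k_j), r'_j := conj(r_j/k_j), s'_j := -conj(s_j/k_j), and define infinite matrices C₁, C₂ : ℤ × ℤ → ℂ by (C₁)_{a,b} := Σ_{j=1}^{M} r_j·s_j·k_j^{a+b} and (C₂)_{a,b} := Σ_{j=1}^{M} r'_j·s'_j·l_j^{a+b} (integer powers). Then for all a, b ∈ ℤ: conj((C₁)_{a,b}) = -(-1)^{a+b}·(C₂)_{-a-1,-b-1} and conj((C₂)_{a,b}) = -(-1)^{a+b}·(C₁)_{-a-1,-b-1}. (Section 4.1 of the paper: under the Euclidean-space reduction l_j = -1/k_j*, ρ₂(l_j) = (ρ₁(k_j)/k_j)*, σ₂(l_j) = -(σ₁(k_j)/k_j)*, one has C₁* = -Ξ·Λ·Θ·C₂·Θ·Λᵀ·Ξ and C₂* = -Ξ·Λ·Θ·C₁·Θ·Λᵀ·Ξ.)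 -/
theorem neg_one_div_zpow {K : Type*} [Field K] (x : K) (n : ℤ) :
    (-1 / x) ^ n = (-1) ^ n * x ^ (-n) := by
  rw [div_zpow, zpow_neg, div_eq_mul_inv]

theorem neg_one_zpow_mul_self {K : Type*} [Field K] (n : ℤ) :
    (-1 : K) ^ n * (-1) ^ n = 1 := by
  rw [← mul_zpow]
  simp

/-- Section 4.1, Euclidean reduction: with `l_j = -1/k_j*`,
`r'_j = (r_j/k_j)*`, `s'_j = -(s_j/k_j)*`, the matrices
`(C₁)_{a,b} = Σ_j r_j s_j k_j^{a+b}` and `(C₂)_{a,b} = Σ_j r'_j s'_j l_j^{a+b}`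
satisfy `C₁* = -Ξ·Λ·Θ·C₂·Θ·Λᵀ·Ξ` and `C₂* = -Ξ·Λ·Θ·C₁·Θ·Λᵀ·Ξ`, i.e. entrywise
`conj((C₁)_{a,b}) = -(-1)^{a+b}·(C₂)_{-a-1,-b-1}` and vice versa. -/
theorem stmt_12 (M : ℕ) (hM : 0 < M)
    (k r s : Fin M → ℂ) (hk : ∀ j, k j ≠ 0)
    (l r' s' : Fin M → ℂ)
    (hl : ∀ j, l j = -1 / (starRingEnd ℂ) (k j))
    (hr' : ∀ j, r' j = (starRingEnd ℂ) (r j / k j))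
    (hs' : ∀ j, s' j = -(starRingEnd ℂ) (s j / k j))
    (C₁ C₂ : ℤ → ℤ → ℂ)
    (hC₁ : ∀ a b : ℤ, C₁ a b = ∑ j, r j * s j * (k j) ^ (a + b))
    (hC₂ : ∀ a b : ℤ, C₂ a b = ∑ j, r' j * s' j * (l j) ^ (a + b)) :
    ∀ a b : ℤ,
      (starRingEnd ℂ) (C₁ a b) = -(-1 : ℂ) ^ (a + b) * C₂ (-a - 1) (-b - 1) ∧
      (starRingEnd ℂ) (C₂ a b) = -(-1 : ℂ) ^ (a + b) * C₁ (-a - 1) (-b - 1) := by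
  intro a b
  have hexp : -a - 1 + (-b - 1) = -(a + b) - 2 := by ring
  simp only [hC₁, hC₂, hexp, map_sum, Finset.mul_sum]
  generalize a + b = n
  refine ⟨Finset.sum_congr rfl fun j _ => ?_, Finset.sum_congr rfl fun j _ => ?_⟩
  · have hkj : (starRingEnd ℂ) (k j) ≠ 0 := by simpa using hk j
    have hsign : (-1 : ℂ) ^ (-n - 2) = (-1) ^ n := by
      rw [zpow_sub₀ (by norm_num), zpow_neg, ← inv_zpow]
      norm_num
    have hpow : (starRingEnd ℂ) (k j) ^ (-(-n - 2)) =
        (starRingEnd ℂ) (k j) ^ n * (starRingEnd ℂ) (k j) ^ 2 := by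
      rw [show -(-n - 2) = n + 2 by ring, zpow_add₀ hkj]
      norm_cast
    rw [hr', hs', hl, neg_one_div_zpow, hsign, hpow]
    simp only [map_mul, map_div₀, map_zpow₀]
    field_simp
    linear_combination (-(starRingEnd ℂ) (r j) * (starRingEnd ℂ) (s j)) *
      neg_one_zpow_mul_self (K := ℂ) n
  · have hpow : k j ^ (-n - 2) = k j ^ (-n) / k j ^ 2 := by
      rw [zpow_sub₀ (hk j)]
      norm_cast
    rw [hr', hs', hl, hpow]
    simp only [map_mul, map_neg, map_div₀, map_zpow₀, Complex.conj_conj, map_one,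
      neg_one_div_zpow]
    ring
end

section
/- Under the Euclidean-space conjugation reduction one has σ(U) = -Ξ·Λ·Θ·V·Θ·Λ*·Ξ and σ(Ū) = Ξ·Λ·Θ·V̄·Θ·Λ*·Ξ. (Section 4.1 of the paper: U* = -Ξ·Λ·Θ·V·Θ·Λᵀ·Ξ and Ū* = Ξ·Λ·Θ·V̄·Θ·Λᵀ·Ξ.) -/
/-- If two ring homomorphisms agree up to sign on `x` and `y`, they do so on the inverses. -/
theorem RingHom.map_invOf_eq_neg {R S : Type*} [Ring R] [Ring S] (f g : R →+* S) {x y : R}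
    [Invertible x] [Invertible y] (h : f x = -g y) : f (⅟x) = -g (⅟y) := by
  refine left_inv_eq_right_inv (a := f x) ?_ ?_
  · rw [← map_mul, invOf_mul_self, map_one]
  · rw [h, neg_mul_neg, ← map_mul, mul_invOf_self, map_one]

/-- Section 4.1, Euclidean-space conjugation reduction:
`σ(U) = -Ξ·Λ·Θ·V·Θ·Λ*·Ξ` and `σ(Ū) = Ξ·Λ·Θ·V̄·Θ·Λ*·Ξ`. -/
theorem stmt_13 (R : Type*) [Ring R] [StarRing R]
    (Ω C₁ C₂ : R)
    (hΩ : star Ω = -Ω) (hC₁s : star C₁ = C₁) (hC₂s : star C₂ = C₂)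
    [Invertible C₁] [Invertible C₂]
    [Invertible (⅟C₁ - Ω * C₂ * Ω)] [Invertible (⅟C₂ - Ω * C₁ * Ω)]
    (U V Ub Vb : R)
    (hU : U = ⅟(⅟C₁ - Ω * C₂ * Ω))
    (hV : V = ⅟(⅟C₂ - Ω * C₁ * Ω))
    (hUb : Ub = -(U * Ω * C₂))
    (hVb : Vb = -(V * Ω * C₁))
    (Λ Θ Ξ : R)
    (hΛ1 : Λ * star Λ = 1) (hΛ2 : star Λ * Λ = 1)
    (hΘ : Θ * Θ = 1) (hΞ : Ξ * Ξ = 1)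
    (hΩΞ : Ω * Ξ = -(Ξ * Ω))
    (hΘΩΘ : Θ * Ω * Θ = -(star Λ * Ω * Λ))
    (σ : R →+* R)
    (hσΩ : σ Ω = Ω)
    (hσC₁ : σ C₁ = -(Ξ * Λ * Θ * C₂ * Θ * star Λ * Ξ))
    (hσC₂ : σ C₂ = -(Ξ * Λ * Θ * C₁ * Θ * star Λ * Ξ)) :
    σ U = -(Ξ * Λ * Θ * V * Θ * star Λ * Ξ) ∧
    σ Ub = Ξ * Λ * Θ * Vb * Θ * star Λ * Ξ := by
  let u : Rˣ :=
    { val := Ξ * Λ * Θ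
      inv := Θ * star Λ * Ξ
      val_inv := by
        calc Ξ * Λ * Θ * (Θ * star Λ * Ξ) = Ξ * (Λ * (Θ * Θ) * star Λ) * Ξ := by noncomm_ring
          _ = 1 := by rw [hΘ, mul_one, hΛ1, mul_one, hΞ]
      inv_val := by
        calc Θ * star Λ * Ξ * (Ξ * Λ * Θ) = Θ * (star Λ * (Ξ * Ξ) * Λ) * Θ := by noncomm_ring
          _ = 1 := by rw [hΞ, mul_one, hΛ2, mul_one, hΘ] }
  let τ : R →+* R := MulSemiringAction.toRingHom (ConjAct Rˣ) R (ConjAct.toConjAct u)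
  have hτ (x : R) : Ξ * Λ * Θ * x * Θ * star Λ * Ξ = τ x := by
    change _ = Ξ * Λ * Θ * x * (Θ * star Λ * Ξ)
    simp only [mul_assoc]
  have hτΩ : τ Ω = Ω := by
    calc τ Ω = Ξ * Λ * (Θ * Ω * Θ) * star Λ * Ξ := by rw [← hτ]; noncomm_ring
      _ = -(Ξ * ((Λ * star Λ) * Ω * (Λ * star Λ)) * Ξ) := by rw [hΘΩΘ]; noncomm_ring
      _ = -(Ξ * (Ω * Ξ)) := by rw [hΛ1]; noncomm_ring
      _ = (Ξ * Ξ) * Ω := by rw [hΩΞ]; noncomm_ring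
      _ = Ω := by rw [hΞ, one_mul]
  rw [hτ] at hσC₁ hσC₂
  have hσU : σ U = -τ V := by
    rw [hU, hV]
    apply RingHom.map_invOf_eq_neg
    simp only [map_sub, map_mul, hσΩ, hτΩ, hσC₂, RingHom.map_invOf_eq_neg σ τ hσC₁]
    noncomm_ring
  rw [hτ, hτ]
  refine ⟨hσU, ?_⟩
  simp only [hUb, hVb, map_neg, map_mul, hσU, hσΩ, hσC₂, hτΩ, neg_mul, mul_neg, neg_neg]
end

section
/- Under the ultrahyperbolic-space 𝕌₁ conjugation reduction one has σ(U) = Λ·Θ·V·Θ·Λ* and σ(Ū) = -Λ·Θ·V̄·Θ·Λ*. (Section 4.2 of the paper: U* = Λ·Θ·V·Θ·Λᵀ and Ū* = -Λ·Θ·V̄·Θ·Λᵀ.) -/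
/-- Conjugation `x ↦ P * x * Q` by an element `P` with inverse `Q`, as a ring homomorphism. -/
def conjRingHom {R : Type*} [Ring R] (P Q : R) (hPQ : P * Q = 1) (hQP : Q * P = 1) : R →+* R where
  toFun x := P * x * Q
  map_one' := by rw [mul_one, hPQ]
  map_mul' x y := by
    rw [show P * x * Q * (P * y * Q) = P * x * (Q * P) * y * Q by simp only [mul_assoc], hQP]
    simp only [mul_one, mul_assoc]
  map_zero' := by simp
  map_add' x y := by rw [mul_add, add_mul]

/-- If two ring homomorphisms agree on invertible elements `a` and `b`, they agree on their
inverses. -/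
theorem RingHom.map_invOf_eq_of_map_eq {R S : Type*} [Ring R] [Ring S] (f g : R →+* S) {a b : R}
    [Invertible a] [Invertible b] (h : f a = g b) : f (⅟a) = g (⅟b) := by
  refine left_inv_eq_right_inv (a := f a) ?_ ?_
  · rw [← map_mul, invOf_mul_self, map_one]
  · rw [h, ← map_mul, mul_invOf_self, map_one]


/-- Section 4.2, ultrahyperbolic-space 𝕌₁ conjugation reduction:
`σ(U) = Λ·Θ·V·Θ·Λ*` and `σ(Ū) = -Λ·Θ·V̄·Θ·Λ*`. -/
theorem stmt_16 (R : Type*) [Ring R] [StarRing R]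
    (Ω C₁ C₂ : R)
    (hΩ : star Ω = -Ω) (hC₁s : star C₁ = C₁) (hC₂s : star C₂ = C₂)
    [Invertible C₁] [Invertible C₂]
    [Invertible (⅟C₁ - Ω * C₂ * Ω)] [Invertible (⅟C₂ - Ω * C₁ * Ω)]
    (U V Ub Vb : R)
    (hU : U = ⅟(⅟C₁ - Ω * C₂ * Ω))
    (hV : V = ⅟(⅟C₂ - Ω * C₁ * Ω))
    (hUb : Ub = -(U * Ω * C₂))
    (hVb : Vb = -(V * Ω * C₁))
    (Λ Θ : R)
    (hΛ1 : Λ * star Λ = 1) (hΛ2 : star Λ * Λ = 1)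
    (hΘ : Θ * Θ = 1)
    (hΘΩΘ : Θ * Ω * Θ = -(star Λ * Ω * Λ))
    (σ : R →+* R)
    (hσΩ : σ Ω = Ω)
    (hσC₁ : σ C₁ = Λ * Θ * C₂ * Θ * star Λ)
    (hσC₂ : σ C₂ = Λ * Θ * C₁ * Θ * star Λ) :
    σ U = Λ * Θ * V * Θ * star Λ ∧
    σ Ub = -(Λ * Θ * Vb * Θ * star Λ) := by
  have hPQ : Λ * Θ * (Θ * star Λ) = 1 := by
    rw [mul_assoc, ← mul_assoc Θ, hΘ, one_mul, hΛ1]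
  have hQP : Θ * star Λ * (Λ * Θ) = 1 := by
    rw [mul_assoc, ← mul_assoc (star Λ), hΛ2, one_mul, hΘ]
  let φ : R →+* R := conjRingHom (Λ * Θ) (Θ * star Λ) hPQ hQP
  have hφ (x : R) : Λ * Θ * x * Θ * star Λ = φ x := mul_assoc _ _ _
  have hφΩ : φ Ω = -Ω := by
    rw [← hφ, show Λ * Θ * Ω * Θ * star Λ = Λ * (Θ * Ω * Θ) * star Λ by simp only [mul_assoc],
      hΘΩΘ, mul_neg, neg_mul,
      show Λ * (star Λ * Ω * Λ) * star Λ = Λ * star Λ * Ω * (Λ * star Λ) by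
        simp only [mul_assoc], hΛ1, one_mul, mul_one]
  rw [hφ] at hσC₁ hσC₂
  have hσU : σ U = φ V := by
    rw [hU, hV]
    apply RingHom.map_invOf_eq_of_map_eq
    simp only [map_sub, map_mul, hσΩ, hσC₂, hφΩ, neg_mul, mul_neg, neg_neg,
      RingHom.map_invOf_eq_of_map_eq σ φ hσC₁]
  rw [hφ, hφ]
  refine ⟨hσU, ?_⟩
  simp only [hUb, hVb, map_neg, map_mul, hσU, hσΩ, hσC₂, hφΩ, neg_mul, mul_neg, neg_neg]
end

section
/- Let U, V, Ū, V̄ : ℤ × ℤ → ℂ be infinite matrices such that U and V are symmetric (U_{i,j} = U_{j,i}, V_{i,j} = V_{j,i}) and V̄_{i,j} = -Ū_{j,i} for all i, j. Assume the conjugation relations conj(U_{i,j}) = -V_{i,j} and conj(Ū_{i,j}) = V̄_{i,j} for all i, j, and assume that for all i, j ∈ ℤ: U_{i,j+1} - U_{i+1,j} = Ū_{i,0}·U_{0,j} + U_{i,0}·V̄_{0,j}; V_{i,j+1} - V_{i+1,j} = V̄_{i,0}·V_{0,j} + V_{i,0}·Ū_{0,j}; Ū_{i,j+1} - Ū_{i+1,j}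 = Ū_{i,0}·Ū_{0,j} + U_{i,0}·V_{0,j}; and V̄_{i,j+1} - V̄_{i+1,j} = V̄_{i,0}·V̄_{0,j} + V_{i,0}·U_{0,j}. Then the 2×2 complex matrix P := [[1 - V̄_{0,-1}, -V_{0,-1}], [-U_{0,-1}, 1 - Ū_{0,-1}]] is unitary: P†·P = I₂. (Section 4.3 of the paper: with W := I₂ + 𝕋^{(-1,0)} one has W·P = I₂ and P* = Wᵀ, so the solution P of the SU(2) ASDYM equation in the ultrahyperbolic space 𝕌₂ satisfies the gauge condition P†·P = I₂.) -/
open Matrix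

/-- Section 4.3: under the 𝕌₂ reduction the matrix
`P = [[1 - V̄_{0,-1}, -V_{0,-1}], [-U_{0,-1}, 1 - Ū_{0,-1}]]` is unitary:
`P†·P = I₂`. -/
theorem stmt_19 (U V Ub Vb : ℤ → ℤ → ℂ)
    (hUsymm : ∀ i j : ℤ, U i j = U j i)
    (hVsymm : ∀ i j : ℤ, V i j = V j i)
    (hVb : ∀ i j : ℤ, Vb i j = -Ub j i)
    (hUconj : ∀ i j : ℤ, (starRingEnd ℂ) (U i j) = -V i j)
    (hUbconj : ∀ i j : ℤ, (starRingEnd ℂ) (Ub i j) = Vb i j)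
    (hrelU : ∀ i j : ℤ,
      U i (j + 1) - U (i + 1) j = Ub i 0 * U 0 j + U i 0 * Vb 0 j)
    (hrelV : ∀ i j : ℤ,
      V i (j + 1) - V (i + 1) j = Vb i 0 * V 0 j + V i 0 * Ub 0 j)
    (hrelUb : ∀ i j : ℤ,
      Ub i (j + 1) - Ub (i + 1) j = Ub i 0 * Ub 0 j + U i 0 * V 0 j)
    (hrelVb : ∀ i j : ℤ,
      Vb i (j + 1) - Vb (i + 1) j = Vb i 0 * Vb 0 j + V i 0 * U 0 j) :
    (!![1 - Vb 0 (-1), -V 0 (-1); -U 0 (-1), 1 - Ub 0 (-1)] :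
      Matrix (Fin 2) (Fin 2) ℂ)ᴴ
      * !![1 - Vb 0 (-1), -V 0 (-1); -U 0 (-1), 1 - Ub 0 (-1)] = 1 := by
  have hVbconj : (starRingEnd ℂ) (Vb 0 (-1)) = Ub 0 (-1) := by
    rw [← hUbconj, Complex.conj_conj]
  have hVconj : (starRingEnd ℂ) (V 0 (-1)) = -U 0 (-1) := by
    rw [← neg_eq_iff_eq_neg.mpr (hUconj 0 (-1)), map_neg, Complex.conj_conj]
  have hdet : (1 - Ub 0 (-1)) * (1 - Vb 0 (-1)) - V 0 (-1) * U 0 (-1) = 1 := by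
    have h := hrelUb (-1) (-1)
    have hUb : Ub (-1) 0 = -Vb 0 (-1) := by rw [hVb, neg_neg]
    norm_num at h
    rw [hUb, hUsymm (-1) 0] at h
    linear_combination h
  ext i j
  fin_cases i <;> fin_cases j <;>
    simp [Matrix.mul_apply, Fin.sum_univ_two, hVbconj, hVconj, hUconj, hUbconj] <;>
    first | linear_combination hdet | ring
end
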